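/- Let W ⊆ ℝ^n be a linear subspace, X ⊆ ℝ^n open, K ⊆ X compact and nonempty, and x ∈ X \ K. Assume that every W-regular curve γ : [0,∞) → X with γ(0) = x which approaches the boundary of X in the one-point compactification has image intersecting K. Then the connected component Z of x in (x+W) ∩ (X \ K) is a bounded set, and the boundary of Z in the subspace topology of the affine subspace x+W is contained in K ∩ (x+W). -/

import Mathlib

open Set Filter

/-- Piecewise continuously differentiable on `[a,b]`: there is a finite partition
`a = t₀ < t₁ < … < t_k = b` such that `γ` is `C¹` on each `[t_{j-1}, t_j]`. -/
def PiecewiseC1On {E : Type*} [NormedAddCommGroup E] [NormedSpace ℝ E]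
    (γ : ℝ → E) (a b : ℝ) : Prop :=
  ∃ (k : ℕ) (t : Fin (k + 1) → ℝ), StrictMono t ∧ t 0 = a ∧ t (Fin.last k) = b ∧
    ∀ j : Fin k, ContDiffOn ℝ 1 γ (Set.Icc (t j.castSucc) (t j.succ))

/-- `W`-regular curve on the interval `I`: continuous, piecewise continuously
differentiable, with derivative in `W` wherever it exists. -/
def WRegularOn {E : Type*} [NormedAddCommGroup E] [NormedSpace ℝ E]
    (W : Submodule ℝ E) (γ : ℝ → E) (I : Set ℝ) : Prop :=
  ContinuousOn γ I ∧
  (∀ a b : ℝ, a ∈ I → b ∈ I → a < b → PiecewiseC1On γ a b) ∧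
  (∀ t ∈ I, DifferentiableAt ℝ γ t → deriv γ t ∈ W)

/-- `γ` approaches the boundary of `X` in the one-point compactification: along some
sequence of times tending to `∞` either the distance to the complement of `X` tends
to `0` or the norm tends to `∞`. -/
def ApproachesBoundary {E : Type*} [NormedAddCommGroup E]
    (X : Set E) (γ : ℝ → E) : Prop :=
  ∃ u : ℕ → ℝ, Filter.Tendsto u Filter.atTop Filter.atTop ∧
    (Filter.Tendsto (fun j => Metric.infDist (γ (u j)) Xᶜ) Filter.atTop (nhds 0) ∨
      Filter.Tendsto (fun j => ‖γ (u j)‖) Filter.atTop Filter.atTop)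

/-- The boundary of `S` in the subspace topology of `F`, viewed as a subset of the
ambient space. -/
def bdryIn {E : Type*} [TopologicalSpace E] (F S : Set E) : Set E :=
  Subtype.val '' (frontier ((Subtype.val ⁻¹' S) : Set F))

open scoped Topology

theorem PiecewiseC1On.of_contDiffOn {E : Type*} [NormedAddCommGroup E] [NormedSpace ℝ E]
    {γ : ℝ → E} {a b : ℝ} (hab : a < b) (h : ContDiffOn ℝ 1 γ (Icc a b)) :
    PiecewiseC1On γ a b := by
  refine ⟨1, ![a, b], ?_, rfl, rfl, ?_⟩
  · rw [Fin.strictMono_iff_lt_succ]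
    intro i
    fin_cases i
    simpa using hab
  · intro j
    fin_cases j
    simpa using h

theorem PiecewiseC1On.append {E : Type*} [NormedAddCommGroup E] [NormedSpace ℝ E]
    {γ : ℝ → E} {a b c : ℝ} (h : PiecewiseC1On γ a b) (hbc : b < c)
    (hγ : ContDiffOn ℝ 1 γ (Icc b c)) : PiecewiseC1On γ a c := by
  obtain ⟨k, t, ht, h0, hl, hC⟩ := h
  refine ⟨k + 1, Fin.snoc (α := fun _ => ℝ) t c, ?_, ?_, ?_, ?_⟩
  · rw [Fin.strictMono_iff_lt_succ]
    intro i
    induction i using Fin.lastCases with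
    | last => simpa [hl] using hbc
    | cast i =>
      rw [← Fin.castSucc_succ, Fin.snoc_castSucc, Fin.snoc_castSucc]
      exact ht Fin.castSucc_lt_succ
  · rw [← Fin.castSucc_zero, Fin.snoc_castSucc, h0]
  · exact Fin.snoc_last _ _
  · intro i
    induction i using Fin.lastCases with
    | last => simpa [hl] using hγ
    | cast i =>
      rw [← Fin.castSucc_succ, Fin.snoc_castSucc, Fin.snoc_castSucc]
      exact hC i

theorem piecewiseC1On_of_forall_nat {E : Type*} [NormedAddCommGroup E] [NormedSpace ℝ E]
    {γ : ℝ → E} (h : ∀ k : ℕ, ContDiffOn ℝ 1 γ (Icc (k : ℝ) (k + 1)))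
    {a b : ℝ} (ha : 0 ≤ a) (hab : a < b) : PiecewiseC1On γ a b := by
  have key : ∀ N : ℕ, ∀ b : ℝ, a < b → b ≤ N → PiecewiseC1On γ a b := by
    intro N
    induction N with
    | zero => intro b hab hb; simp at hb; linarith
    | succ N ih =>
      intro b hab hb
      push_cast at hb
      rcases le_or_gt b N with hbN | hbN
      · exact ih b hab hbN
      rcases le_or_gt (N : ℝ) a with haN | haN
      · exact .of_contDiffOn hab ((h N).mono (Icc_subset_Icc haN hb))
      · exact (ih N haN le_rfl).append hbN ((h N).mono (Icc_subset_Icc le_rfl hb))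
  exact key ⌈b⌉₊ b hab (Nat.le_ceil b)

theorem continuousOn_Ici_of_forall_nat {E : Type*} [TopologicalSpace E]
    {γ : ℝ → E} (h : ∀ k : ℕ, ContinuousOn γ (Icc (k : ℝ) (k + 1))) :
    ContinuousOn γ (Ici 0) := by
  have key : ∀ N : ℕ, ContinuousOn γ (Icc (0 : ℝ) N) := by
    intro N
    induction N with
    | zero => simp
    | succ N ih =>
      push_cast
      rw [← Icc_union_Icc_eq_Icc (Nat.cast_nonneg N) (by linarith : (N : ℝ) ≤ N + 1)]
      exact ih.union_of_isClosed (h N) isClosed_Icc isClosed_Icc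
  intro t ht
  obtain ⟨N, hN⟩ := exists_nat_gt t
  refine ((key N) t ⟨ht, hN.le⟩).mono_of_mem_nhdsWithin ?_
  filter_upwards [self_mem_nhdsWithin, mem_nhdsWithin_of_mem_nhds (Iio_mem_nhds hN)] with s hs hs'
  exact ⟨hs, le_of_lt hs'⟩

theorem deriv_mem_of_forall_sub_mem {E : Type*} [NormedAddCommGroup E] [NormedSpace ℝ E]
    {W : Submodule ℝ E} (hW : IsClosed (W : Set E)) {γ : ℝ → E} {x : E} {a t : ℝ} (ht : a ≤ t)
    (h : ∀ s, a ≤ s → γ s - x ∈ W) (hd : DifferentiableAt ℝ γ t) : deriv γ t ∈ W := by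
  have hs := (hasDerivAt_iff_tendsto_slope.1 hd.hasDerivAt).mono_left
    (nhdsWithin_mono t fun s (hs : s ∈ Ioi t) => ne_of_gt hs)
  refine hW.mem_of_tendsto hs ?_
  filter_upwards [self_mem_nhdsWithin] with s hs
  rw [slope_def_module]
  refine W.smul_mem _ ?_
  simpa using W.sub_mem (h s (ht.trans (le_of_lt hs))) (h t ht)

/-- The polygonal curve through the points `v 0, v 1, …`, at `v k` at time `k`. -/
noncomputable def polygonal {E : Type*} [AddCommGroup E] [Module ℝ E] (v : ℕ → E) (t : ℝ) : E :=
  AffineMap.lineMap (v ⌊t⌋₊) (v (⌊t⌋₊ + 1)) (t - ⌊t⌋₊)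

theorem polygonal_natCast {E : Type*} [AddCommGroup E] [Module ℝ E] (v : ℕ → E) (k : ℕ) :
    polygonal v k = v k := by
  simp [polygonal]

theorem polygonal_eqOn {E : Type*} [AddCommGroup E] [Module ℝ E] (v : ℕ → E) (k : ℕ) :
    EqOn (polygonal v) (fun t => AffineMap.lineMap (v k) (v (k + 1)) (t - k))
      (Icc (k : ℝ) (k + 1)) := by
  rintro t ⟨h1, h2⟩
  rcases h2.lt_or_eq with h2 | rfl
  · have : ⌊t⌋₊ = k := (Nat.floor_eq_iff ((Nat.cast_nonneg k).trans h1)).2 ⟨h1, h2⟩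
    simp [polygonal, this]
  · have := polygonal_natCast v (k + 1)
    push_cast at this
    simp [this]

theorem polygonal_mem {E : Type*} [AddCommGroup E] [Module ℝ E] {v : ℕ → E} {Z : Set E}
    (hv : ∀ k, segment ℝ (v k) (v (k + 1)) ⊆ Z) {t : ℝ} (ht : 0 ≤ t) : polygonal v t ∈ Z := by
  apply hv ⌊t⌋₊
  rw [segment_eq_image_lineMap]
  exact ⟨_, ⟨sub_nonneg.2 (Nat.floor_le ht), by linarith [Nat.lt_floor_add_one t]⟩, rfl⟩

theorem contDiffOn_polygonal {E : Type*} [NormedAddCommGroup E] [NormedSpace ℝ E]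
    (v : ℕ → E) (k : ℕ) : ContDiffOn ℝ 1 (polygonal v) (Icc (k : ℝ) (k + 1)) := by
  refine ContDiffOn.congr ?_ (polygonal_eqOn v k)
  simp only [AffineMap.lineMap_apply_module']
  fun_prop

theorem wRegularOn_polygonal {E : Type*} [NormedAddCommGroup E] [NormedSpace ℝ E]
    {W : Submodule ℝ E} (hW : IsClosed (W : Set E)) {v : ℕ → E} {x : E}
    (hv : ∀ k, segment ℝ (v k) (v (k + 1)) ⊆ {y | y - x ∈ W}) :
    WRegularOn W (polygonal v) (Ici 0) :=
  ⟨continuousOn_Ici_of_forall_nat fun k => (contDiffOn_polygonal v k).continuousOn,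
    fun _ _ ha _ hab => piecewiseC1On_of_forall_nat (contDiffOn_polygonal v) ha hab,
    fun _ ht hd => deriv_mem_of_forall_sub_mem hW ht (fun _ hs => polygonal_mem hv hs) hd⟩

theorem Relation.TransGen.exists_seq {α : Type*} {r : α → α → Prop} {a b : α}
    (h : Relation.TransGen r a b) :
    ∃ (m : ℕ) (p : ℕ → α), 0 < m ∧ p 0 = a ∧ p m = b ∧ ∀ i < m, r (p i) (p (i + 1)) := by
  induction h with
  | @single b hab =>
    refine ⟨1, fun i => if i = 0 then a else b, one_pos, by simp, by simp, ?_⟩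
    intro i hi
    obtain rfl : i = 0 := by omega
    simpa using hab
  | @tail b c _ hbc ih =>
    obtain ⟨m, p, hm, h0, hl, hp⟩ := ih
    refine ⟨m + 1, fun i => if i ≤ m then p i else c, by omega, by simp [h0], by simp, ?_⟩
    intro i hi
    rcases Nat.lt_succ_iff_lt_or_eq.1 hi with hi | rfl
    · simpa [hi.le, Nat.succ_le_of_lt hi] using hp i hi
    · simpa [hl] using hbc

/-- Finite `r`-chains joining consecutive terms of `z` concatenate to an infinite `r`-chain. -/
theorem Relation.TransGen.exists_chain_through {α : Type*} {r : α → α → Prop} {z : ℕ → α}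
    (h : ∀ j, Relation.TransGen r (z j) (z (j + 1))) :
    ∃ (v : ℕ → α) (k : ℕ → ℕ), v 0 = z 0 ∧ (∀ i, r (v i) (v (i + 1))) ∧
      (∀ j, v (k j) = z j) ∧ Tendsto k atTop atTop := by
  choose m p hm h0 hl hp using fun j => (h j).exists_seq
  let s : ℕ → ℕ × ℕ := fun i => Nat.rec (0, 0)
    (fun _ q => if q.2 + 1 < m q.1 then (q.1, q.2 + 1) else (q.1 + 1, 0)) i
  have hs : ∀ i, s (i + 1) =
      if (s i).2 + 1 < m (s i).1 then ((s i).1, (s i).2 + 1) else ((s i).1 + 1, 0) := fun _ => rfl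
  have hlt : ∀ i, (s i).2 < m (s i).1 := by
    intro i
    induction i with
    | zero => exact hm 0
    | succ i _ =>
      rw [hs]
      split_ifs with hi
      · exact hi
      · exact hm _
  have hblock : ∀ k j, s k = (j, 0) → ∀ i < m j, s (k + i) = (j, i) := by
    intro k j hk i
    induction i with
    | zero => exact fun _ => hk
    | succ i ih =>
      intro hi
      rw [← add_assoc, hs, ih (by omega)]
      simp [hi]
  have hstart : ∀ j, s (∑ i ∈ Finset.range j, m i) = (j, 0) := by
    intro j
    induction j with
    | zero => rfl
    | succ j ih =>
      have hlast := hblock _ _ ih (m j - 1) (Nat.sub_lt (hm j) one_pos)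
      have hmj : m j - 1 + 1 = m j := Nat.sub_add_cancel (hm j)
      rw [Finset.sum_range_succ, ← hmj, ← add_assoc, hs, hlast]
      simp [hmj]
  refine ⟨fun i => p (s i).1 (s i).2, fun j => ∑ i ∈ Finset.range j, m i, h0 0, fun i => ?_,
    fun j => by simp only [hstart, h0], ?_⟩
  · have hr := hp _ _ (hlt i)
    dsimp only
    rw [hs]
    split_ifs with hi
    · exact hr
    · rwa [show (s i).2 + 1 = m (s i).1 by have := hlt i; omega, hl, ← h0] at hr
  · refine tendsto_atTop_mono (fun j => ?_) tendsto_id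
    simpa using Finset.card_nsmul_le_sum (Finset.range j) m 1 fun i _ => hm i

theorem convex_setOf_sub_mem {E : Type*} [AddCommGroup E] [Module ℝ E]
    (W : Submodule ℝ E) (x : E) : Convex ℝ {y | y - x ∈ W} := by
  have h := W.convex.translate_preimage_right (-x)
  simpa [preimage, sub_eq_neg_add] using h

theorem exists_ball_inter_subset_connectedComponentIn {E : Type*} [NormedAddCommGroup E]
    [NormedSpace ℝ E] {F U : Set E} (hF : Convex ℝ F) (hU : IsOpen U) {y : E}
    (hy : y ∈ F ∩ U) :
    ∃ ε > 0, F ∩ Metric.ball y ε ⊆ connectedComponentIn (F ∩ U) y := by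
  obtain ⟨ε, hε, hb⟩ := Metric.isOpen_iff.1 hU y hy.2
  exact ⟨ε, hε, (hF.inter (convex_ball y ε)).isPreconnected.subset_connectedComponentIn
    ⟨hy.1, Metric.mem_ball_self hε⟩ (inter_subset_inter_right F hb)⟩

theorem transGen_segment_subset_connectedComponentIn {E : Type*} [NormedAddCommGroup E]
    [NormedSpace ℝ E] {F U : Set E} (hF : Convex ℝ F) (hU : IsOpen U) {x a b : E}
    (ha : a ∈ connectedComponentIn (F ∩ U) x) (hb : b ∈ connectedComponentIn (F ∩ U) x) :
    Relation.TransGen (fun p q => segment ℝ p q ⊆ connectedComponentIn (F ∩ U) x) a b := by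
  refine isPreconnected_connectedComponentIn.induction₂' _ (fun y hy => ?_)
    (fun _ _ _ _ _ _ => Relation.TransGen.trans) ha hb
  have hyFU := connectedComponentIn_subset _ _ hy
  obtain ⟨ε, hε, hsub⟩ := exists_ball_inter_subset_connectedComponentIn hF hU hyFU
  rw [← connectedComponentIn_eq hy] at hsub
  filter_upwards [self_mem_nhdsWithin, mem_nhdsWithin_of_mem_nhds (Metric.ball_mem_nhds y hε)]
    with w hw hwb
  have hseg : segment ℝ y w ⊆ connectedComponentIn (F ∩ U) x :=
    ((hF.inter (convex_ball y ε)).segment_subset ⟨hyFU.1, Metric.mem_ball_self hε⟩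
      ⟨(connectedComponentIn_subset _ _ hw).1, hwb⟩).trans hsub
  exact ⟨.single hseg, .single (segment_symm ℝ y w ▸ hseg)⟩

theorem exists_wRegularOn_through {E : Type*} [NormedAddCommGroup E] [NormedSpace ℝ E]
    {W : Submodule ℝ E} (hW : IsClosed (W : Set E)) {U : Set E} (hU : IsOpen U) {x : E}
    (hx : x ∈ U) {z : ℕ → E} (hz : ∀ j, z j ∈ connectedComponentIn ({y | y - x ∈ W} ∩ U) x) :
    ∃ (γ : ℝ → E) (u : ℕ → ℝ), WRegularOn W γ (Ici 0) ∧
      MapsTo γ (Ici 0) (connectedComponentIn ({y | y - x ∈ W} ∩ U) x) ∧ γ 0 = x ∧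
      Tendsto u atTop atTop ∧ ∀ j, γ (u j) = z j := by
  have hxZ : x ∈ connectedComponentIn ({y | y - x ∈ W} ∩ U) x :=
    mem_connectedComponentIn ⟨by simp, hx⟩
  let z' : ℕ → E := fun j => Nat.casesOn j x z
  have hz' : ∀ j, z' j ∈ connectedComponentIn ({y | y - x ∈ W} ∩ U) x := by
    rintro (_ | j)
    exacts [hxZ, hz j]
  obtain ⟨v, k, hv0, hv, hvk, hk⟩ := Relation.TransGen.exists_chain_through fun j =>
    transGen_segment_subset_connectedComponentIn (convex_setOf_sub_mem W x) hU (hz' j) (hz' (j + 1))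
  refine ⟨polygonal v, fun j => (k (j + 1) : ℝ), wRegularOn_polygonal hW fun i => (hv i).trans
      ((connectedComponentIn_subset _ _).trans inter_subset_left),
    fun t ht => polygonal_mem hv ht, ?_, ?_, fun j => ?_⟩
  · have := polygonal_natCast v 0
    rwa [Nat.cast_zero, hv0] at this
  · exact tendsto_natCast_atTop_atTop.comp (hk.comp (tendsto_add_atTop_nat 1))
  · rw [polygonal_natCast, hvk]

theorem connected_component_bounded_of_curves_meet_K
    (n : ℕ) (W : Submodule ℝ (EuclideanSpace ℝ (Fin n)))
    (X : Set (EuclideanSpace ℝ (Fin n))) (hX : IsOpen X)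
    (K : Set (EuclideanSpace ℝ (Fin n))) (hK : IsCompact K) (hKne : K.Nonempty)
    (hKX : K ⊆ X) (x : EuclideanSpace ℝ (Fin n)) (hx : x ∈ X \ K)
    (hcurves : ∀ γ : ℝ → EuclideanSpace ℝ (Fin n),
      WRegularOn W γ (Set.Ici 0) → Set.MapsTo γ (Set.Ici 0) X → γ 0 = x →
      ApproachesBoundary X γ → (γ '' Set.Ici 0 ∩ K).Nonempty) :
    Bornology.IsBounded (connectedComponentIn ({y | y - x ∈ W} ∩ (X \ K)) x) ∧
    bdryIn {y | y - x ∈ W} (connectedComponentIn ({y | y - x ∈ W} ∩ (X \ K)) x)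
      ⊆ K ∩ {y | y - x ∈ W} := by
  set F : Set (EuclideanSpace ℝ (Fin n)) := {y | y - x ∈ W}
  set Z := connectedComponentIn (F ∩ (X \ K)) x
  have hU : IsOpen (X \ K) := hX.sdiff hK.isClosed
  have hZsub : Z ⊆ F ∩ (X \ K) := connectedComponentIn_subset _ _
  have escape : ∀ z : ℕ → EuclideanSpace ℝ (Fin n), (∀ j, z j ∈ Z) →
      ¬ (Tendsto (fun j => Metric.infDist (z j) Xᶜ) atTop (𝓝 0) ∨
        Tendsto (fun j => ‖z j‖) atTop atTop) := by
    intro z hz hlim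
    obtain ⟨γ, u, hreg, hmaps, h0, hu, huz⟩ :=
      exists_wRegularOn_through W.closed_of_finiteDimensional hU hx hz
    obtain ⟨_, ⟨t, ht, rfl⟩, hK'⟩ := hcurves γ hreg (fun t ht => (hZsub (hmaps ht)).2.1) h0
      ⟨u, hu, by simpa only [huz] using hlim⟩
    exact (hZsub (hmaps ht)).2.2 hK'
  refine ⟨?_, ?_⟩
  · by_contra hb
    have hfar : ∀ j : ℕ, ∃ z ∈ Z, (j : ℝ) < ‖z‖ := by
      by_contra! ⟨j, hj⟩
      exact hb (isBounded_iff_forall_norm_le.2 ⟨j, hj⟩)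
    choose z hz hzj using hfar
    exact escape z hz (.inr (tendsto_atTop_mono (fun j => (hzj j).le) tendsto_natCast_atTop_atTop))
  · rintro _ ⟨p, ⟨hpcl, hpint⟩, rfl⟩
    refine ⟨?_, p.2⟩
    by_contra hpK
    have hcl : (p : EuclideanSpace ℝ (Fin n)) ∈ closure Z :=
      closure_mono (image_preimage_subset _ _)
        (image_closure_subset_closure_image continuous_subtype_val (mem_image_of_mem _ hpcl))
    by_cases hpX : (p : EuclideanSpace ℝ (Fin n)) ∈ X
    · obtain ⟨ε, hε, hsub⟩ := exists_ball_inter_subset_connectedComponentIn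
        (convex_setOf_sub_mem W x) hU ⟨p.2, hpX, hpK⟩
      obtain ⟨q, hqZ, hq⟩ := Metric.mem_closure_iff.1 hcl ε hε
      have hqp := hsub ⟨(hZsub hqZ).1, Metric.mem_ball'.2 hq⟩
      rw [connectedComponentIn_eq hqp, ← connectedComponentIn_eq hqZ] at hsub
      refine hpint (mem_interior_iff_mem_nhds.2 ?_)
      filter_upwards [continuous_subtype_val.continuousAt.preimage_mem_nhds
        (Metric.ball_mem_nhds (p : EuclideanSpace ℝ (Fin n)) hε)] with w hw
      exact hsub ⟨w.2, hw⟩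
    · obtain ⟨z, hz, hzp⟩ := mem_closure_iff_seq_limit.1 hcl
      refine escape z hz (.inl ?_)
      rw [← Metric.infDist_zero_of_mem (show (p : EuclideanSpace ℝ (Fin n)) ∈ Xᶜ from hpX)]
      exact ((Metric.continuous_infDist_pt Xᶜ).tendsto _).comp hzp
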